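/- Let X be a countable type, λ > 0 a real number, and k : X → ℝ a summable function with k y ≥ 0 for all y; set K := Σ'_y k y. Define μ : (X →₀ ℕ) → ℝ by μ f := (1/(1+λK)) · ((Σ_{y ∈ supp f} f y)! / Π_{y ∈ supp f} (f y)!) · Π_{y ∈ supp f} (λ · k y / (1+λK))^{f y}. Then for every z : X → ℝ with 0 ≤ z y ≤ 1 for all y, the family f ↦ μ f · Π_{y ∈ supp f} (z y)^{f y} is summable over all f : X →₀ ℕ and Σ'_{f : X →₀ ℕ} μ f · Π_{y ∈ supp f} (z y)^{f y} = 1 / (1 + λ · Σ'_y (k y · (1 - z y))). In particular (taking z ≡ 1), μ is a probability distribution on X →₀ ℕ. -/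

import Mathlib

noncomputable def Mterm {X : Type*} (a : X → ℝ) (f : X →₀ ℕ) : ℝ :=
  ((Nat.factorial (∑ y ∈ f.support, f y) : ℝ) /
          ∏ y ∈ f.support, (Nat.factorial (f y) : ℝ)) * ∏ y ∈ f.support, a y ^ f y

lemma Mterm_nonneg {X : Type*} (a : X → ℝ) (ha : ∀ y, 0 ≤ a y) (f : X →₀ ℕ) :
    0 ≤ Mterm a f := by
  unfold Mterm
  have := Finset.prod_nonneg (s := f.support) (fun y _ => pow_nonneg (ha y) (f y))
  positivity

lemma Mterm_eq {X : Type*} (a : X → ℝ) (f : X →₀ ℕ) (s : Finset X) (h : f.support ⊆ s) :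
    Mterm a f = (Nat.multinomial s f : ℝ) * ∏ y ∈ s, a y ^ f y := by
  have h0 : ∏ y ∈ f.support, a y ^ f y = ∏ y ∈ s, a y ^ f y := by
    apply Finset.prod_subset h
    intro x _ hx
    simp [Finsupp.notMem_support_iff.1 hx]
  rw [Mterm, h0, Finsupp.multinomial_of_support_subset h, Finsupp.multinomial_eq]
  congr 1
  rw [div_eq_iff (by positivity)]
  rw [mul_comm]
  exact_mod_cast (Nat.multinomial_spec f.support f).symm

lemma Mterm_sum {X : Type*} [DecidableEq X] (a : X → ℝ) (s : Finset X) (n : ℕ) :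
    ∑ f ∈ s.finsuppAntidiag n, Mterm a f = (∑ y ∈ s, a y) ^ n := by
  rw [Finset.sum_pow_eq_sum_piAntidiag]
  refine Finset.sum_bij (fun f _ => (f : X → ℕ)) ?_ ?_ ?_ ?_
  · intro f hf
    rw [Finset.mem_finsuppAntidiag] at hf
    rw [Finset.mem_piAntidiag]
    exact ⟨hf.1, fun i hi => hf.2 (Finsupp.mem_support_iff.2 hi)⟩
  · intro f _ g _ h
    exact DFunLike.coe_injective h
  · intro g hg
    rw [Finset.mem_piAntidiag] at hg
    refine ⟨Finsupp.onFinset s g hg.2, ?_, rfl⟩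
    rw [Finset.mem_finsuppAntidiag]
    exact ⟨hg.1, Finsupp.support_onFinset_subset⟩
  · intro f hf
    rw [Finset.mem_finsuppAntidiag] at hf
    exact Mterm_eq a f s hf.2

lemma Mterm_sum_range {X : Type*} [DecidableEq X] (a : X → ℝ) (s : Finset X) (N : ℕ) :
    ∑ f ∈ (Finset.range N).biUnion (fun n => s.finsuppAntidiag n), Mterm a f
      = ∑ n ∈ Finset.range N, (∑ y ∈ s, a y) ^ n := by
  rw [Finset.sum_biUnion]
  · exact Finset.sum_congr rfl fun n _ => Mterm_sum a s n
  · intro i _ j _ hij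
    refine Finset.disjoint_left.2 fun f hf hg => hij ?_
    rw [Finset.mem_finsuppAntidiag] at hf hg
    exact hf.1.symm.trans hg.1

lemma Mterm_hasSum {X : Type*} (a : X → ℝ) (ha : ∀ y, 0 ≤ a y) (hs : Summable a)
    (h1 : ∑' y, a y < 1) : HasSum (Mterm a) (1 - ∑' y, a y)⁻¹ := by
  classical
  have hA0 : 0 ≤ ∑' y, a y := tsum_nonneg ha
  have hg := hasSum_geometric_of_lt_one hA0 h1
  refine hasSum_of_isLUB_of_nonneg _ (Mterm_nonneg a ha) ⟨?_, ?_⟩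
  · rintro _ ⟨F, rfl⟩
    let s := F.biUnion (fun f => f.support)
    let N := F.sup (fun f => ∑ y ∈ s, f y) + 1
    have hsub : F ⊆ (Finset.range N).biUnion (fun n => s.finsuppAntidiag n) := by
      intro f hf
      rw [Finset.mem_biUnion]
      refine ⟨∑ y ∈ s, f y, ?_, ?_⟩
      · rw [Finset.mem_range, Nat.lt_succ_iff]
        exact Finset.le_sup (f := fun f : X →₀ ℕ => ∑ y ∈ s, f y) hf
      · rw [Finset.mem_finsuppAntidiag]
        exact ⟨rfl, Finset.subset_biUnion_of_mem (fun f : X →₀ ℕ => f.support) hf⟩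
    calc ∑ f ∈ F, Mterm a f
        ≤ _ := Finset.sum_le_sum_of_subset_of_nonneg hsub (fun f _ _ => Mterm_nonneg a ha f)
      _ = _ := Mterm_sum_range a s N
      _ ≤ ∑ n ∈ Finset.range N, (∑' y, a y) ^ n := by
          refine Finset.sum_le_sum fun n _ => pow_le_pow_left₀
            (Finset.sum_nonneg fun y _ => ha y) (hs.sum_le_tsum s fun y _ => ha y) n
      _ ≤ _ := sum_le_hasSum _ (fun n _ => pow_nonneg hA0 n) hg
  · intro B hB
    refine le_of_tendsto hg.tendsto_sum_nat (Filter.Eventually.of_forall fun N => ?_)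
    have ht : Filter.Tendsto (fun s : Finset X => ∑ n ∈ Finset.range N, (∑ y ∈ s, a y) ^ n)
        Filter.atTop (nhds (∑ n ∈ Finset.range N, (∑' y, a y) ^ n)) :=
      tendsto_finsetSum _ fun n _ => hs.hasSum.pow n
    refine le_of_tendsto ht (Filter.Eventually.of_forall fun s => ?_)
    rw [← Mterm_sum_range]
    exact hB ⟨_, rfl⟩

open scoped BigOperators

theorem generating_function_geometric_multinomial
    {X : Type*} [Countable X] (lam : ℝ) (hlam : 0 < lam)
    (k : X → ℝ) (hk : Summable k) (hknn : ∀ y, 0 ≤ k y)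
    (K : ℝ) (hK : K = ∑' y, k y)
    (μ : (X →₀ ℕ) → ℝ)
    (hμ : ∀ f : X →₀ ℕ, μ f =
      (1 / (1 + lam * K)) *
        ((Nat.factorial (∑ y ∈ f.support, f y) : ℝ) /
          ∏ y ∈ f.support, (Nat.factorial (f y) : ℝ)) *
        ∏ y ∈ f.support, (lam * k y / (1 + lam * K)) ^ (f y)) :
    (∀ z : X → ℝ, (∀ y, 0 ≤ z y ∧ z y ≤ 1) →
      Summable (fun f : X →₀ ℕ => μ f * ∏ y ∈ f.support, (z y) ^ (f y)) ∧
      (∑' f : X →₀ ℕ, μ f * ∏ y ∈ f.support, (z y) ^ (f y))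
        = 1 / (1 + lam * ∑' y, k y * (1 - z y))) ∧
    Summable μ ∧ (∑' f : X →₀ ℕ, μ f) = 1 := by
  have hK0 : 0 ≤ K := hK ▸ tsum_nonneg hknn
  have hD : 0 < 1 + lam * K := by positivity
  have key : ∀ z : X → ℝ, (∀ y, 0 ≤ z y ∧ z y ≤ 1) →
      HasSum (fun f : X →₀ ℕ => μ f * ∏ y ∈ f.support, (z y) ^ (f y))
        (1 / (1 + lam * ∑' y, k y * (1 - z y))) := by
    intro z hz
    have hkz : Summable (fun y => k y * z y) :=
      Summable.of_nonneg_of_le (fun y => mul_nonneg (hknn y) (hz y).1)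
        (fun y => mul_le_of_le_one_right (hknn y) (hz y).2) hk
    have hle : ∑' y, k y * z y ≤ K := by
      rw [hK]
      exact hkz.tsum_le_tsum (fun y => mul_le_of_le_one_right (hknn y) (hz y).2) hk
    have hae : ∀ y, lam * k y / (1 + lam * K) * z y = lam / (1 + lam * K) * (k y * z y) := by
      intro y; ring
    have hsum : HasSum (fun y => lam * k y / (1 + lam * K) * z y)
        (lam / (1 + lam * K) * ∑' y, k y * z y) := by
      simp_rw [hae]
      exact hkz.hasSum.mul_left _
    have hlt : lam / (1 + lam * K) * ∑' y, k y * z y < 1 := by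
      rw [div_mul_eq_mul_div, div_lt_one hD]
      nlinarith
    have hM := Mterm_hasSum (fun y => lam * k y / (1 + lam * K) * z y)
      (fun y => mul_nonneg (div_nonneg (mul_nonneg hlam.le (hknn y)) hD.le) (hz y).1)
      hsum.summable (by rw [hsum.tsum_eq]; exact hlt)
    rw [hsum.tsum_eq] at hM
    have hM2 := hM.mul_left (1 / (1 + lam * K))
    have hd : ∑' y, k y * (1 - z y) = K - ∑' y, k y * z y := by
      rw [hK, ← hk.tsum_sub hkz]
      exact tsum_congr fun y => by ring
    have hne : 1 + lam * (K - ∑' y, k y * z y) ≠ 0 := by nlinarith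
    have hval : 1 / (1 + lam * ∑' y, k y * (1 - z y)) =
        1 / (1 + lam * K) * (1 - lam / (1 + lam * K) * ∑' y, k y * z y)⁻¹ := by
      rw [hd, one_div, one_div, ← mul_inv]
      congr 1
      field_simp
      ring
    rw [hval]
    refine (congrArg (fun g => HasSum g _) (funext ?_)).mpr hM2
    intro f
    rw [hμ, Mterm]
    simp_rw [mul_pow]
    rw [Finset.prod_mul_distrib]
    ring
  have h1 := key (fun _ => 1) (fun _ => by norm_num)
  simp only [one_pow, Finset.prod_const_one, mul_one, sub_self, mul_zero, tsum_zero, add_zero,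
    div_one] at h1
  exact ⟨fun z hz => ⟨(key z hz).summable, (key z hz).tsum_eq⟩, h1.summable, h1.tsum_eq⟩
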